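/- There exists a Steiner triple system of order 91 admitting a strict 4-bicoloring, that is, a partition of its 91 points into 4 nonempty color classes such that every block intersects exactly two of the classes. -/

import Mathlib

/-- `(V, B)` is a Steiner triple system: every block is a 3-element subset of `V`,
and every pair of distinct points of `V` lies in exactly one block. -/
def IsSTS (V : Finset ℕ) (B : Finset (Finset ℕ)) : Prop :=
  (∀ b ∈ B, b.card = 3 ∧ b ⊆ V) ∧
  ∀ x ∈ V, ∀ y ∈ V, x ≠ y → ∃! b, b ∈ B ∧ x ∈ b ∧ y ∈ b

/-- The order-seven permutation of the points with fixed points `0, …, 6` and the twelve orbits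
`{7 k, …, 7 k + 6}`, `1 ≤ k ≤ 12`, raised to the power `i`. -/
def rotate (i x : ℕ) : ℕ :=
  if x < 7 then x else x / 7 * 7 + (x + i) % 7

/-- The index of the orbit of a point under `rotate`. -/
def orbitIndex (x : ℕ) : ℕ :=
  if x < 7 then x else x / 7 + 6

/-- The color of a point; it depends only on the orbit. -/
def color (x : ℕ) : ℕ :=
  3333332221103322220 / 10 ^ orbitIndex x % 10

/-- Read in base 100, digit `y` of `thirdPointRow k` is the third point of the block through `y`
and the smallest point of the orbit with index `k`. -/
def thirdPointRow : ℕ → ℕ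
  | 0 => 69686766656463515049555453526261605958575690898887868584767574737271708079787783828137363541403938454443424847461211100908071316151420191817242322212726252834333231302905060304010200
  | 1 => 82818079787783849089888786856665646369686772717076757473535251504955545756626160595824232221272625090807131211101918171615142044434248474645283433323130293837363541403904030605000002
  | 2 => 75747372717076535251504955548490898887868539383736354140484746454443427877838281807962616059585756646369686766650807131211100915142019181716252423222127263231302928343303040506000001
  | 3 => 59585756626160757473727170767783828180797849555453525150868584908988876867666564636917161514201918071312111009082423222127262530292834333231444342484746454039383736354102010000060504
  | 4 => 33323130292834696867666564635352515049555483828180797877424847464544437170767574737261605958575662100908071312118490898887868514201918171615262524232221273736354140393801020000050603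
  | 5 => 25242322212726302928343332311312111009080720191817161514464544434248473635414039383757566261605958535251504955548079787783828185849089888786696867666564637675747372717000000201040306
  | 6 => 26252423222127354140393837364746454443424830292834333231201918171615140807131211100970767574737271828180797877836665646369686784908988878685626160595857565352515049555400000102030405
  | 7 => 84558176646690727588798065568782595283580560615785788662636869747167778906097312495045352848310813031101043410473702304432004626271517212023221819241425164251403653430054703841333929
  | 8 => 86875089905762736453176061185970698354517574676852498205847879765585065872816671886535464703223632283134373843483930424033014104020013084411091277800710002419211520231656632745262925
  | 9 => 73697871050658607659637088538224669025877989645574506880616283818449516752775456655733383601422044303732474046343548390341282908127275070900431310000204111926141822272385861531164517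
  | 10 => 66507942610454586205788880696071654968754477720690745957828676648363525184475655897311530717702387141526081822242710161912210034390335433629013137453240410030483302384667818525092013
  | 11 => 76708257735051068869643749409056678661528981637443028068557258536087756205597184857814070027256620187723267919002116122217152445384428393134423641303329480932040113034783541108651046
  | 12 => 54788328596966884977537489817033796750067685517384416052045764860561023090806368728216260811211700652324000915202275141055128719470139403444352703434836320729453137461371586218562538
  | 13 => 8403420304441454200240235171939162804481103224647142718382632150121361323332925070071666783853182848975620556788853604386527364615180546857877663777459655510701206905009377269795881
  | 14 => 46263003411520291733162425071235371831110034324513100809223848444023002701192821393660059067590402865850617449756981687288835255897879576251845373828085066676716563647714474387425470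
  | 15 => 22114632431300123620214129044515300133253816352723371700070810483428092619444224031859398876538652790247706582685872870674785767557151669080815449646975058583896056616231147750407384
  | 16 => 39350825270236224512182103094214343016430024310133174638102915403713004704321941201106556482287176515990635884897466536873614486238769268379505280657260755781496277880548075478856756
  | 17 => 37434827330110113242453412000326150847230928392516381304242220291930074102210044461788725080518981553568659006407986820557596987756762716153605814496674186478838470735636316376548552
  | 18 => 7161915180800013124444538100225221137403612482942132300143903332147204328173035094168573279805566497161787270510459468252675406057581647458568886538987626569737750859027263460768363
  | _ => 0

/-- The third point of the block through two distinct points. -/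
def thirdPoint (x y : ℕ) : ℕ :=
  if x < 7 then thirdPointRow x / 100 ^ y % 100
  else rotate (x % 7) (thirdPointRow (orbitIndex x) / 100 ^ rotate (7 - x % 7) y % 100)

/-- The blocks `{x, y, t x y}` for distinct `x, y < n`. -/
@[irreducible] def tripleBlocks (n : ℕ) (t : ℕ → ℕ → ℕ) : Finset (Finset ℕ) :=
  ((Finset.range n ×ˢ Finset.range n).filter fun p => p.1 ≠ p.2).image
    fun p => {p.1, p.2, t p.1 p.2}

theorem mem_tripleBlocks {n : ℕ} {t : ℕ → ℕ → ℕ} {b : Finset ℕ} :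
    b ∈ tripleBlocks n t ↔ ∃ x < n, ∃ y < n, x ≠ y ∧ b = {x, y, t x y} := by
  simp only [tripleBlocks, Finset.mem_image, Finset.mem_filter, Finset.mem_product,
    Finset.mem_range, Prod.exists]
  constructor
  · rintro ⟨x, y, ⟨⟨hx, hy⟩, hxy⟩, rfl⟩
    exact ⟨x, hx, y, hy, hxy, rfl⟩
  · rintro ⟨x, hx, y, hy, hxy, rfl⟩
    exact ⟨x, y, ⟨⟨hx, hy⟩, hxy⟩, rfl⟩

/-- A Steiner quasigroup operation on `range n`, used only off the diagonal, gives a Steiner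
triple system. -/
theorem isSTS_tripleBlocks {n : ℕ} {t : ℕ → ℕ → ℕ}
    (ht : ∀ x < n, ∀ y < n, x ≠ y →
      t x y < n ∧ t x y ≠ x ∧ t x y = t y x ∧ t x (t x y) = y) :
    IsSTS (Finset.range n) (tripleBlocks n t) := by
  refine ⟨fun b hb => ?_, fun x hx y hy hxy => ?_⟩
  · obtain ⟨x, hx, y, hy, hxy, rfl⟩ := mem_tripleBlocks.1 hb
    obtain ⟨hlt, hne, hcomm, -⟩ := ht x hx y hy hxy
    have hne' : t x y ≠ y := hcomm ▸ (ht y hy x hx hxy.symm).2.1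
    refine ⟨Finset.card_eq_three.2 ⟨x, y, t x y, hxy, hne.symm, hne'.symm, rfl⟩, ?_⟩
    simp only [Finset.insert_subset_iff, Finset.singleton_subset_iff, Finset.mem_range]
    exact ⟨hx, hy, hlt⟩
  · rw [Finset.mem_range] at hx hy
    refine ⟨{x, y, t x y}, ⟨mem_tripleBlocks.2 ⟨x, hx, y, hy, hxy, rfl⟩, by simp, by simp⟩, ?_⟩
    rintro b ⟨hb, hxb, hyb⟩
    obtain ⟨u, hu, v, hv, huv, rfl⟩ := mem_tripleBlocks.1 hb
    obtain ⟨hlt, hne, hcomm, hinv⟩ := ht u hu v hv huv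
    obtain ⟨-, hne', -, hinv'⟩ := ht v hv u hu huv.symm
    rw [← hcomm] at hne' hinv'
    have hcu := (ht u hu _ hlt hne.symm).2.2.1
    have hcv := (ht v hv _ hlt hne'.symm).2.2.1
    simp only [Finset.mem_insert, Finset.mem_singleton] at hxb hyb
    ext z
    simp only [Finset.mem_insert, Finset.mem_singleton]
    grind

theorem thirdPoint_spec : ∀ x < 91, ∀ y < 91, x ≠ y →
    thirdPoint x y < 91 ∧ thirdPoint x y ≠ x ∧ thirdPoint x y = thirdPoint y x ∧
      thirdPoint x (thirdPoint x y) = y := by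
  decide +kernel

theorem color_thirdPoint : ∀ x < 91, ∀ y < 91, x ≠ y →
    if color x = color y then color (thirdPoint x y) ≠ color x
    else color (thirdPoint x y) = color x ∨ color (thirdPoint x y) = color y := by
  decide +kernel

theorem color_lt : ∀ x < 91, color x < 4 := by
  decide +kernel

/-- The points of color `i`. -/
def colorClass (i : ℕ) : Finset ℕ :=
  (Finset.range 91).filter fun x => color x = i

theorem disjoint_colorClass {i j : ℕ} (h : i ≠ j) : Disjoint (colorClass i) (colorClass j) :=
  Finset.disjoint_filter.2 fun _ _ hi hj => h (hi.symm.trans hj)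

theorem triple_inter_colorClass_nonempty {x y z : ℕ} (hx : x < 91) (hy : y < 91) (hz : z < 91)
    (i : ℕ) : (({x, y, z} : Finset ℕ) ∩ colorClass i).Nonempty ↔
      color x = i ∨ color y = i ∨ color z = i := by
  simp only [Finset.Nonempty, Finset.mem_inter, Finset.mem_insert, Finset.mem_singleton,
    colorClass, Finset.mem_filter, Finset.mem_range]
  constructor
  · rintro ⟨w, rfl | rfl | rfl, -, hw⟩ <;> simp [hw]
  · rintro (h | h | h)
    exacts [⟨x, by simp, hx, h⟩, ⟨y, by simp, hy, h⟩, ⟨z, by simp, hz, h⟩]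

theorem number_of_colors_eq_two : ∀ a < 4, ∀ b < 4, ∀ c < 4,
    (if a = b then c ≠ a else c = a ∨ c = b) →
    (((if a = 0 ∨ b = 0 ∨ c = 0 then 1 else 0) +
      (if a = 1 ∨ b = 1 ∨ c = 1 then 1 else 0) +
      (if a = 2 ∨ b = 2 ∨ c = 2 then 1 else 0) +
      (if a = 3 ∨ b = 3 ∨ c = 3 then 1 else 0) : ℕ) = 2) := by
  decide +kernel

theorem stmt_13 :
    ∃ (V : Finset ℕ) (B : Finset (Finset ℕ)),
      V.card = 91 ∧ IsSTS V B ∧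
      ∃ X1 X2 X3 X4 : Finset ℕ,
        X1.Nonempty ∧
        X2.Nonempty ∧
        X3.Nonempty ∧
        X4.Nonempty ∧
        Disjoint X1 X2 ∧
        Disjoint X1 X3 ∧
        Disjoint X1 X4 ∧
        Disjoint X2 X3 ∧
        Disjoint X2 X4 ∧
        Disjoint X3 X4 ∧
        X1 ∪ X2 ∪ X3 ∪ X4 = V ∧
        ∀ b ∈ B,
          (((if (b ∩ X1).Nonempty then 1 else 0) +
           (if (b ∩ X2).Nonempty then 1 else 0) +
           (if (b ∩ X3).Nonempty then 1 else 0) +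
           (if (b ∩ X4).Nonempty then 1 else 0) : ℕ) = 2) := by
  refine ⟨Finset.range 91, tripleBlocks 91 thirdPoint, Finset.card_range 91,
    isSTS_tripleBlocks thirdPoint_spec, colorClass 0, colorClass 1, colorClass 2, colorClass 3,
    ⟨0, by decide +kernel⟩, ⟨14, by decide +kernel⟩, ⟨1, by decide +kernel⟩,
    ⟨5, by decide +kernel⟩,
    disjoint_colorClass (by decide), disjoint_colorClass (by decide),
    disjoint_colorClass (by decide), disjoint_colorClass (by decide),
    disjoint_colorClass (by decide), disjoint_colorClass (by decide), ?_, fun b hb => ?_⟩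
  · ext x
    simp only [colorClass, Finset.mem_union, Finset.mem_filter, Finset.mem_range]
    have := color_lt x
    grind
  · rw [mem_tripleBlocks] at hb
    obtain ⟨x, hx, y, hy, hxy, rfl⟩ := hb
    have hz := (thirdPoint_spec x hx y hy hxy).1
    have hc := color_thirdPoint x hx y hy hxy
    have hcx := color_lt x hx
    have hcy := color_lt y hy
    have hcz := color_lt _ hz
    simp only [triple_inter_colorClass_nonempty hx hy hz]
    generalize color x = a, color y = b, color (thirdPoint x y) = c at *
    exact number_of_colors_eq_two a hcx b hcy c hcz hc
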